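/- arXiv:2306.11178 — 2 statements merged into one kernel-verified Lean document; each statement's English description precedes it below -/
import Mathlib

section
/- Let 1 < γ < 2 and s > 3. Let ω : [0,∞) → ℝ satisfy that s ↦ ω²(s)s is integrable on (0,∞), and set j(x) = ∫₀^{r(x)} ω²(s)s ds and j_∞ = ∫₀^∞ ω²(s)s ds. Suppose ρ : ℝ³ → ℝ is continuous, nonnegative, satisfies sup_x (1+|x|)^s ρ(x) < ∞, and solves ρ(x) = [(1/|·| * ρ)(x) + κ² j(x) + α]₊^{1/(γ−1)} for all x ∈ ℝ³, where α, κ ∈ ℝ satisfy κ² j_∞ + α < 0. Then ρ is compactly supported; i.e., there exists R > 0 such that ρ(x) = 0 for all |x| ≥ R. -/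
open MeasureTheory Real

/-- The Newtonian potential `(1/|·| * ρ)(x) = ∫ ρ(y)/|x−y| dy` on `ℝ³`. -/
noncomputable def pot (ρ : EuclideanSpace ℝ (Fin 3) → ℝ) (x : EuclideanSpace ℝ (Fin 3)) : ℝ :=
  ∫ y, ρ y / ‖x - y‖

/-- The cylindrical radius `r(x) = √(x₁² + x₂²)`. -/
noncomputable def cylRad (x : EuclideanSpace ℝ (Fin 3)) : ℝ :=
  Real.sqrt ((x 0)^2 + (x 1)^2)

/-- The kernel `1/|z|` truncated to the unit ball is integrable on `ℝ³`. -/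
lemma integrable_indicator_inv_norm :
    Integrable (fun z : EuclideanSpace ℝ (Fin 3) =>
      (Set.Iio (1:ℝ)).indicator (fun t => t⁻¹) ‖z‖) := by
  rw [integrable_fun_norm_addHaar volume (f := (Set.Iio (1:ℝ)).indicator (fun t => t⁻¹))]
  have hdom : IntegrableOn ((Set.Iio (1:ℝ)).indicator fun _ => (1:ℝ)) (Set.Ioi 0) := by
    rw [IntegrableOn, integrable_indicator_iff measurableSet_Iio, IntegrableOn,
      Measure.restrict_restrict measurableSet_Iio, Set.inter_comm, Set.Ioi_inter_Iio]
    exact integrableOn_const (by simp)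
  refine Integrable.mono' hdom ?_ ?_
  · exact ((measurable_id.pow_const _).smul
      (measurable_inv.indicator measurableSet_Iio)).aestronglyMeasurable
  · refine (ae_restrict_iff' measurableSet_Ioi).2 (Filter.Eventually.of_forall fun t ht => ?_)
    have ht : 0 < t := ht
    by_cases h : t < 1
    · simp only [finrank_euclideanSpace, Fintype.card_fin, Set.indicator, Set.mem_Iio, h, if_true,
        smul_eq_mul, Nat.add_one_sub_one]
      rw [pow_two, mul_assoc, mul_inv_cancel₀ ht.ne', mul_one, Real.norm_of_nonneg ht.le]
      exact h.le
    · simp [h]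

lemma integrable_of_decay {s C : ℝ} (hs : 3 < s) {ρ : EuclideanSpace ℝ (Fin 3) → ℝ}
    (hcont : Continuous ρ) (hnonneg : ∀ x, 0 ≤ ρ x)
    (hC : ∀ x : EuclideanSpace ℝ (Fin 3), (1 + ‖x‖)^s * ρ x ≤ C) : Integrable ρ := by
  have h := integrable_one_add_norm (E := EuclideanSpace ℝ (Fin 3)) (μ := volume) (r := s)
    (by simpa using hs)
  refine (h.const_mul C).mono' hcont.aestronglyMeasurable (Filter.Eventually.of_forall fun y => ?_)
  have hy : 0 < 1 + ‖y‖ := by positivity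
  rw [Real.norm_of_nonneg (hnonneg y), Real.rpow_neg hy.le, ← div_eq_mul_inv,
    le_div_iff₀ (by positivity), mul_comm]
  exact hC y

/-- The far part of the potential of an integrable density vanishes at infinity. -/
lemma tendsto_integral_mul_inv_max_one_norm_sub {ρ : EuclideanSpace ℝ (Fin 3) → ℝ}
    (hρ : Integrable ρ) :
    Filter.Tendsto (fun x => ∫ y, ρ y * (max 1 ‖x - y‖)⁻¹)
      (Filter.comap norm Filter.atTop) (nhds 0) := by
  rw [← integral_zero (EuclideanSpace ℝ (Fin 3)) ℝ]
  refine tendsto_integral_filter_of_dominated_convergence (fun y => ‖ρ y‖)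
    (Filter.Eventually.of_forall fun x => ?_) (Filter.Eventually.of_forall fun x =>
      Filter.Eventually.of_forall fun y => ?_) hρ.norm (Filter.Eventually.of_forall fun y => ?_)
  · exact hρ.aestronglyMeasurable.mul (by fun_prop : Measurable _).aestronglyMeasurable
  · rw [norm_mul]
    refine mul_le_of_le_one_right (norm_nonneg _) ?_
    rw [Real.norm_of_nonneg (by positivity)]
    exact inv_le_one_of_one_le₀ (le_max_left _ _)
  · rw [← mul_zero (ρ y)]
    refine Filter.Tendsto.const_mul _ (Filter.Tendsto.inv_tendsto_atTop ?_)
    have hlow : Filter.Tendsto (fun x : EuclideanSpace ℝ (Fin 3) => ‖x‖ - ‖y‖)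
        (Filter.comap norm Filter.atTop) Filter.atTop :=
      Filter.tendsto_atTop_add_const_right _ _ Filter.tendsto_comap
    exact Filter.tendsto_atTop_mono
      (fun x => (norm_sub_norm_le x y).trans (le_max_right _ _)) hlow

/-- Splitting the potential into a near part, controlled by the decay of `ρ`, and a far part. -/
lemma pot_le {s C : ℝ} (hs : 3 < s) {ρ : EuclideanSpace ℝ (Fin 3) → ℝ}
    (hcont : Continuous ρ) (hnonneg : ∀ x, 0 ≤ ρ x)
    (hC : ∀ x : EuclideanSpace ℝ (Fin 3), (1 + ‖x‖)^s * ρ x ≤ C)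
    {x : EuclideanSpace ℝ (Fin 3)} (hx : 0 < ‖x‖) :
    pot ρ x ≤ C * ‖x‖ ^ (-s) * (∫ z : EuclideanSpace ℝ (Fin 3),
        (Set.Iio (1:ℝ)).indicator (fun t => t⁻¹) ‖z‖) + ∫ y, ρ y * (max 1 ‖x - y‖)⁻¹ := by
  have hρ := integrable_of_decay hs hcont hnonneg hC
  have hC0 : 0 ≤ C := (mul_nonneg (by positivity) (hnonneg 0)).trans (hC 0)
  have hk := (integrable_indicator_inv_norm.comp_sub_left x).const_mul (C * ‖x‖ ^ (-s))
  have hfar : Integrable fun y => ρ y * (max 1 ‖x - y‖)⁻¹ := by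
    refine hρ.norm.mono' (hρ.aestronglyMeasurable.mul
      (by fun_prop : Measurable _).aestronglyMeasurable) (Filter.Eventually.of_forall fun y => ?_)
    rw [norm_mul]
    refine mul_le_of_le_one_right (norm_nonneg _) ?_
    rw [Real.norm_of_nonneg (by positivity)]
    exact inv_le_one_of_one_le₀ (le_max_left _ _)
  rw [← integral_sub_left_eq_self (fun z : EuclideanSpace ℝ (Fin 3) =>
    (Set.Iio (1:ℝ)).indicator (fun t => t⁻¹) ‖z‖) volume x, ← integral_const_mul,
    ← integral_add hk hfar]
  refine integral_mono_of_nonneg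
    (Filter.Eventually.of_forall fun y => div_nonneg (hnonneg y) (norm_nonneg _))
    (hk.add hfar) (Filter.Eventually.of_forall fun y => ?_)
  rcases lt_or_ge ‖x - y‖ 1 with h | h
  · have hxy : ‖x‖ ≤ 1 + ‖y‖ := by linarith [norm_sub_norm_le x y]
    have hbound : ρ y ≤ C * ‖x‖ ^ (-s) := by
      rw [Real.rpow_neg hx.le, ← div_eq_mul_inv, le_div_iff₀ (by positivity), mul_comm]
      exact (mul_le_mul_of_nonneg_right
        (Real.rpow_le_rpow hx.le hxy (by linarith)) (hnonneg y)).trans (hC y)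
    have hind : (Set.Iio (1:ℝ)).indicator (fun t => t⁻¹) ‖x - y‖ = ‖x - y‖⁻¹ :=
      Set.indicator_of_mem (Set.mem_Iio.2 h) _
    simp only [hind, div_eq_mul_inv]
    exact (mul_le_mul_of_nonneg_right hbound (by positivity)).trans
      (le_add_of_nonneg_right (mul_nonneg (hnonneg y) (by positivity)))
  · have hind : (Set.Iio (1:ℝ)).indicator (fun t => t⁻¹) ‖x - y‖ = 0 :=
      Set.indicator_of_notMem (by simpa using h) _
    simp [hind, max_eq_right h, div_eq_mul_inv]

/-- If `κ²j_∞ + α < 0`, then any continuous nonnegative decaying solution of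
`ρ = [(1/|·|*ρ) + κ²j + α]₊^{1/(γ−1)}` is compactly supported. -/
theorem rotating_star_compact_support
    (γ : ℝ) (hγ₁ : 1 < γ) (hγ₂ : γ < 2) (s : ℝ) (hs : 3 < s)
    (ω : ℝ → ℝ) (hωint : IntegrableOn (fun t => (ω t)^2 * t) (Set.Ioi (0:ℝ)))
    (J : ℝ → ℝ) (hJ : J = fun r => ∫ t in (0:ℝ)..r, (ω t)^2 * t)
    (jinf : ℝ) (hjinf : jinf = ∫ t in Set.Ioi (0:ℝ), (ω t)^2 * t)
    (α κ : ℝ) (hneg : κ^2 * jinf + α < 0)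
    (ρ : EuclideanSpace ℝ (Fin 3) → ℝ)
    (hcont : Continuous ρ) (hnonneg : ∀ x, 0 ≤ ρ x)
    (hdecay : ∃ C : ℝ, ∀ x : EuclideanSpace ℝ (Fin 3), (1 + ‖x‖)^s * ρ x ≤ C)
    (heq : ∀ x : EuclideanSpace ℝ (Fin 3),
      ρ x = max (pot ρ x + κ^2 * J (cylRad x) + α) 0 ^ (1/(γ-1))) :
    ∃ R : ℝ, 0 < R ∧ ∀ x : EuclideanSpace ℝ (Fin 3), R ≤ ‖x‖ → ρ x = 0 := by
  obtain ⟨C, hC⟩ := hdecay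
  have hnear := (((tendsto_rpow_neg_atTop (by linarith : 0 < s)).comp
    (Filter.tendsto_comap (f := fun x : EuclideanSpace ℝ (Fin 3) => ‖x‖))).const_mul C).mul_const
      (∫ z : EuclideanSpace ℝ (Fin 3), (Set.Iio (1:ℝ)).indicator (fun t => t⁻¹) ‖z‖)
  have hlim := hnear.add (tendsto_integral_mul_inv_max_one_norm_sub
    (integrable_of_decay hs hcont hnonneg hC))
  have hev := hlim.eventually_lt_const
    (by simpa using neg_pos.2 hneg : _ < -(κ^2 * jinf + α))
  obtain ⟨R, hR⟩ := Filter.eventually_atTop.1 (Filter.eventually_comap.1 hev)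
  refine ⟨max R 1, by positivity, fun x hx => ?_⟩
  have hpot : pot ρ x < -(κ^2 * jinf + α) :=
    (pot_le hs hcont hnonneg hC (by linarith [le_max_right R 1])).trans_lt
      (hR ‖x‖ ((le_max_left _ _).trans hx) x rfl)
  have hJle : J (cylRad x) ≤ jinf := by
    rw [hJ, hjinf]
    simp only
    rw [intervalIntegral.integral_of_le (show 0 ≤ cylRad x from Real.sqrt_nonneg _)]
    refine setIntegral_mono_set hωint ?_ Set.Ioc_subset_Ioi_self.eventuallyLE
    exact (ae_restrict_iff' measurableSet_Ioi).2 (Filter.Eventually.of_forall fun t ht =>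
      mul_nonneg (sq_nonneg _) (le_of_lt ht))
  have hκ := mul_le_mul_of_nonneg_left hJle (sq_nonneg κ)
  rw [heq x, max_eq_right (by linarith), Real.zero_rpow]
  exact one_div_ne_zero (by linarith)
end

section
/- (Uniform L^∞ bound via bootstrap) Let 4/3 < γ < 2 and let M, R, C₀ > 0. Then there exists a constant C = C(γ, M, R, C₀) > 0 with the following property: whenever ρ : ℝ³ → ℝ is continuous and nonnegative with ∫_{ℝ³} ρ dx ≤ M and ρ(x) = 0 for |x| > R, and g : ℝ³ → ℝ is a function with g(x) ≤ C₀ for all |x| ≤ R, such that ρ(x) = [(1/|·| * ρ)(x) + g(x)]₊^{1/(γ−1)} for all x ∈ ℝ³, one has sup_{x ∈ ℝ³} ρ(x) ≤ C. -/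
open MeasureTheory Real

/-- The kernel `1/|·|` on `ℝ³`, restricted to the ball of radius `r`, is integrable. -/
lemma integrable_truncated_newton_kernel (r : ℝ) :
    Integrable (fun x : EuclideanSpace ℝ (Fin 3) =>
      (Set.Iio r).indicator (fun t : ℝ => t⁻¹) ‖x‖) := by
  rw [integrable_fun_norm_addHaar volume (f := (Set.Iio r).indicator (fun t : ℝ => t⁻¹))]
  have hI : IntegrableOn (fun t : ℝ => t) (Set.Ioo 0 r) :=
    (continuous_id.integrableOn_Icc (a := 0) (b := r)).mono_set Set.Ioo_subset_Icc_self
  have h := hI.integrable_indicator measurableSet_Ioo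
  refine h.integrableOn.congr_fun (fun t ht => ?_) measurableSet_Ioi
  have ht : 0 < t := ht
  by_cases htr : t < r
  · simp only [Set.indicator, Set.mem_Ioo, Set.mem_Iio, ht, htr, finrank_euclideanSpace,
      Fintype.card_fin, smul_eq_mul, and_self, if_true]
    field_simp
  · simp [Set.indicator, htr]

/-- The integral of `1/|·|` over the ball of radius `r` in `ℝ³`, as a multiple of `r ^ 2`. -/
lemma integral_truncated_newton_kernel {r : ℝ} (hr : 0 ≤ r) :
    ∫ x : EuclideanSpace ℝ (Fin 3), (Set.Iio r).indicator (fun t : ℝ => t⁻¹) ‖x‖ =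
      3 / 2 * (volume : Measure (EuclideanSpace ℝ (Fin 3))).real (Metric.ball 0 1) * r ^ 2 := by
  rw [integral_fun_norm_addHaar volume ((Set.Iio r).indicator (fun t : ℝ => t⁻¹))]
  have h : ∫ t in Set.Ioi (0 : ℝ), t ^ (Module.finrank ℝ (EuclideanSpace ℝ (Fin 3)) - 1) •
      (Set.Iio r).indicator (fun t : ℝ => t⁻¹) t = r ^ 2 / 2 := by
    calc _ = ∫ t in Set.Ioi (0 : ℝ), (Set.Iio r).indicator (fun t : ℝ => t) t := by
          refine setIntegral_congr_fun measurableSet_Ioi (fun t ht => ?_)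
          have ht : 0 < t := ht
          by_cases htr : t < r
          · simp only [Set.indicator, Set.mem_Iio, htr, finrank_euclideanSpace,
              Fintype.card_fin, smul_eq_mul, if_true]
            field_simp
          · simp [Set.indicator, htr]
      _ = ∫ t in (0 : ℝ)..r, t := by
          rw [setIntegral_indicator measurableSet_Iio, Set.Ioi_inter_Iio,
            intervalIntegral.integral_of_le hr, integral_Ioc_eq_integral_Ioo]
      _ = r ^ 2 / 2 := by simp
  rw [h]
  simp only [finrank_euclideanSpace, Fintype.card_fin, smul_eq_mul, nsmul_eq_mul]
  push_cast
  ring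

/-- Splitting the potential at distance `r` bounds it by the supremum and the mass of `ρ`. -/
lemma pot_le_of_le {ρ : EuclideanSpace ℝ (Fin 3) → ℝ} {K M r : ℝ}
    (hρ : Integrable ρ) (h0 : ∀ x, 0 ≤ ρ x) (hK : ∀ x, ρ x ≤ K) (hM : ∫ x, ρ x ≤ M)
    (hr : 0 < r) (x : EuclideanSpace ℝ (Fin 3)) :
    pot ρ x ≤
      K * (3 / 2 * (volume : Measure (EuclideanSpace ℝ (Fin 3))).real (Metric.ball 0 1) * r ^ 2) +
        M / r := by
  have hk := (integrable_truncated_newton_kernel r).comp_sub_left x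
  calc pot ρ x ≤ ∫ y, (K * (Set.Iio r).indicator (fun t : ℝ => t⁻¹) ‖x - y‖ + ρ y / r) := by
        refine integral_mono_of_nonneg
          (Filter.Eventually.of_forall fun y => div_nonneg (h0 y) (norm_nonneg _))
          ((hk.const_mul K).add (hρ.div_const r)) (Filter.Eventually.of_forall fun y => ?_)
        by_cases hy : ‖x - y‖ < r
        · have h1 := mul_le_mul_of_nonneg_right (hK y) (inv_nonneg.2 (norm_nonneg (x - y)))
          have h2 := div_nonneg (h0 y) hr.le
          simp only [Set.indicator, Set.mem_Iio, hy, if_true]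
          rw [div_eq_mul_inv (ρ y) ‖x - y‖]
          linarith
        · have h1 := div_le_div_of_nonneg_left (h0 y) hr (not_lt.1 hy)
          simpa [Set.indicator, hy] using h1
    _ = K * (∫ y, (Set.Iio r).indicator (fun t : ℝ => t⁻¹) ‖x - y‖) + (∫ y, ρ y) / r := by
        rw [integral_add (hk.const_mul K) (hρ.div_const r), integral_const_mul, integral_div]
    _ ≤ _ := by
        rw [integral_sub_left_eq_self
          (fun y : EuclideanSpace ℝ (Fin 3) => (Set.Iio r).indicator (fun t : ℝ => t⁻¹) ‖y‖)
          volume x, integral_truncated_newton_kernel hr.le]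
        gcongr

/-- A sublinear power inequality `K ≤ (D K^{1/3})^q` with `q < 3` bounds `K`. -/
lemma le_of_le_mul_rpow_third {K D q : ℝ} (hK : 0 < K) (hD : 0 < D) (hq : q < 3)
    (h : K ≤ (D * K ^ (1 / 3 : ℝ)) ^ q) : K ≤ (D ^ q) ^ (1 - q / 3)⁻¹ := by
  have hs : 0 < 1 - q / 3 := by linarith
  have hmul : K ≤ D ^ q * K ^ (q / 3) := by
    rwa [mul_rpow hD.le (by positivity), ← rpow_mul hK.le, one_div_mul_eq_div] at h
  rw [le_rpow_inv_iff_of_pos hK.le (by positivity) hs, rpow_sub hK, rpow_one,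
    div_le_iff₀ (by positivity)]
  exact hmul

/-- Uniform `L^∞` bound via bootstrap: for `4/3 < γ < 2`, any continuous nonnegative
density of mass at most `M`, supported in the ball of radius `R`, satisfying
`ρ = [(1/|·|*ρ) + g]₊^{1/(γ−1)}` with `g ≤ C₀` on the ball, is bounded by a constant
depending only on `γ, M, R, C₀`. -/
theorem uniform_Linfty_bound_bootstrap
    (γ : ℝ) (hγ₁ : 4/3 < γ) (hγ₂ : γ < 2)
    (M R C₀ : ℝ) (hM : 0 < M) (hR : 0 < R) (hC₀ : 0 < C₀) :
    ∃ C : ℝ, 0 < C ∧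
      ∀ (ρ : EuclideanSpace ℝ (Fin 3) → ℝ) (g : EuclideanSpace ℝ (Fin 3) → ℝ),
        Continuous ρ → (∀ x, 0 ≤ ρ x) →
        (∫ x, ρ x) ≤ M →
        (∀ x : EuclideanSpace ℝ (Fin 3), R < ‖x‖ → ρ x = 0) →
        (∀ x : EuclideanSpace ℝ (Fin 3), ‖x‖ ≤ R → g x ≤ C₀) →
        (∀ x : EuclideanSpace ℝ (Fin 3),
          ρ x = max (pot ρ x + g x) 0 ^ (1/(γ-1))) →
        ∀ x : EuclideanSpace ℝ (Fin 3), ρ x ≤ C := by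
  set a : ℝ :=
    3 / 2 * (volume : Measure (EuclideanSpace ℝ (Fin 3))).real (Metric.ball 0 1) with ha
  have ha0 : 0 ≤ a := by positivity
  set q : ℝ := 1 / (γ - 1) with hq
  have hγ : 0 < γ - 1 := by linarith
  have hq0 : 0 < q := by positivity
  have hq3 : q < 3 := by
    rw [hq, div_lt_iff₀ hγ]
    linarith
  set D : ℝ := C₀ + a + M
  have hD : 0 < D := by positivity
  refine ⟨max 1 ((D ^ q) ^ (1 - q / 3)⁻¹), by positivity, ?_⟩
  intro ρ g hρ h0 hmass hsupp hg heq
  have hcs : HasCompactSupport ρ :=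
    HasCompactSupport.intro (isCompact_closedBall 0 R) fun x hx =>
      hsupp x (by simpa using hx)
  obtain ⟨z, hz⟩ := hρ.exists_forall_ge_of_hasCompactSupport hcs
  intro x
  refine (hz x).trans ?_
  rcases le_or_gt (ρ z) 1 with h1 | h1
  · exact h1.trans (le_max_left _ _)
  refine le_trans ?_ (le_max_right _ _)
  have hK : 0 < ρ z := by linarith
  refine le_of_le_mul_rpow_third hK hD hq3 ?_
  have hzR : ‖z‖ ≤ R := by
    by_contra! h
    exact hK.ne' (hsupp z h)
  set L : ℝ := ρ z ^ (1 / 3 : ℝ) with hL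
  have hL1 : 1 ≤ L := one_le_rpow h1.le (by norm_num)
  have hL3 : L ^ 3 = ρ z := by
    rw [hL, ← rpow_natCast, ← rpow_mul hK.le]
    norm_num
  have hpot : pot ρ z ≤ (a + M) * L := by
    have h := pot_le_of_le (hρ.integrable_of_hasCompactSupport hcs) h0 hz hmass
      (inv_pos.2 (zero_lt_one.trans_le hL1)) z
    rw [← ha, ← hL3] at h
    refine h.trans (le_of_eq ?_)
    field_simp
  have hbase : max (pot ρ z + g z) 0 ≤ D * L := by
    refine max_le ?_ (by positivity)
    have h2 : C₀ ≤ C₀ * L := le_mul_of_one_le_right hC₀.le hL1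
    have h3 := hg z hzR
    calc pot ρ z + g z ≤ (a + M) * L + C₀ * L := by linarith
      _ = D * L := by ring
  rw [heq z]
  exact rpow_le_rpow (le_max_right _ _) hbase hq0.le
end
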